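/- Let d ≥ 2 be an integer, let {S_j} be a scale sequence and {b_j} a kernel sequence satisfying the flexible-needlet assumptions, and assume in addition that for some M ∈ ℕ there is C_M > 0 with |(Δ⁻)^M (Δ⁺)^M b_j(ℓ)| ≤ C_M/(S_j − S_{j−1})^{2M} for all ℓ and j. Then there exists a constant C'_M > 0 (independent of j and θ) such that for all j ≥ 1 and θ ∈ (0, π], |(cos θ − 1)^M Ψ_j(cos θ)| ≤ C'_M (S_{j+1}^d − S_{j−1}^d) · max{ 1/S_{j−1}^{2M}, 1/(S_j − S_{j−1})^{2M} }, where Ψ_j(cos θ) = Σ_{ℓ ∈ [S_{j−1}, S_{j+1}]} b_j(ℓ) Z_{ℓ;d}(cos θ). -/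

import Mathlib

noncomputable section

/-- `η_d = (d-1)/2`. -/
def etaD (d : ℕ) : ℝ := ((d : ℝ) - 1) / 2

/-- `ω_d = 2 π^((d+1)/2) / Γ((d+1)/2)`. -/
def omegaD (d : ℕ) : ℝ :=
  2 * Real.pi ^ (((d : ℝ) + 1) / 2) / Real.Gamma (((d : ℝ) + 1) / 2)

/-- Gegenbauer polynomials `G_ℓ^{(η)}`, defined by the three-term recurrence
`G_0 = 1`, `G_1(x) = 2ηx`,
`(ℓ+1) G_{ℓ+1}(x) = 2(ℓ+η) x G_ℓ(x) − (ℓ+2η−1) G_{ℓ−1}(x)`. -/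
def gegen (η : ℝ) : ℕ → ℝ → ℝ
  | 0 => fun _ => (1 : ℝ)
  | 1 => fun x => 2 * η * x
  | (n + 2) => fun x =>
      (2 * ((n : ℝ) + 1 + η) * x * gegen η (n + 1) x
        - ((n : ℝ) + 1 + 2 * η - 1) * gegen η n x) / ((n : ℝ) + 2)

/-- The zonal kernel `Z_{ℓ;d}(t) = ((ℓ+η_d)/(η_d ω_d)) G_ℓ^{(η_d)}(t)`. -/
def Zker (d : ℕ) (ℓ : ℕ) (t : ℝ) : ℝ :=
  (((ℓ : ℝ) + etaD d) / (etaD d * omegaD d)) * gegen (etaD d) ℓ t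

/-- Forward difference `(Δ⁺ r)_ℓ = r_{ℓ+1} − r_ℓ`. -/
def deltaPlus (r : ℕ → ℝ) : ℕ → ℝ := fun ℓ => r (ℓ + 1) - r ℓ

/-- Backward difference `(Δ⁻ r)_ℓ = r_ℓ − r_{ℓ−1}`, with the convention `r_{−1} = 0`. -/
def deltaMinus (r : ℕ → ℝ) : ℕ → ℝ :=
  fun ℓ => r ℓ - (if ℓ = 0 then 0 else r (ℓ - 1))

/-- The operator `Υ_d`, `(Υ_d r)_ℓ = υ_{1;d}(ℓ) (Δ⁻Δ⁺ r)_ℓ + υ_{0;d}(ℓ) (Δ⁺ r)_ℓ`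
with `υ_{1;d}(ℓ) = ℓ/(2(ℓ+η_d))` and `υ_{0;d}(ℓ) = 2η_d/(2(ℓ+η_d))`. -/
def upsilon (d : ℕ) (r : ℕ → ℝ) : ℕ → ℝ :=
  fun ℓ =>
    ((ℓ : ℝ) / (2 * ((ℓ : ℝ) + etaD d))) * deltaMinus (deltaPlus r) ℓ
      + ((2 * etaD d) / (2 * ((ℓ : ℝ) + etaD d))) * deltaPlus r ℓ

/-- Coefficients of `(1 - X)^(-η)`. -/
def negBinCoeff (η : ℝ) : ℕ → ℝ
  | 0 => 1
  | (k + 1) => negBinCoeff η k * (η + k) / (k + 1)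

lemma negBinCoeff_nonneg (η : ℝ) (hη : 0 ≤ η) (k : ℕ) : 0 ≤ negBinCoeff η k := by
  induction k with
  | zero => simp [negBinCoeff]
  | succ k ih => rw [negBinCoeff]; positivity

/-- The power series `(1 - z X)^(-η)`. -/
def negBinSeries (η : ℝ) (z : ℂ) : PowerSeries ℂ :=
  PowerSeries.mk (fun k => (negBinCoeff η k : ℂ) * z ^ k)

open PowerSeries in
lemma negBinSeries_ode (η : ℝ) (z : ℂ) :
    (1 - C z * X) * PowerSeries.derivative ℂ (negBinSeries η z)
      = C (η * z) * negBinSeries η z := by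
  ext n
  have key : ∀ k : ℕ, ((k : ℂ) + 1) * (negBinCoeff η (k + 1) : ℂ)
      = (η + k) * (negBinCoeff η k : ℂ) := by
    intro k
    have h : ((k : ℂ) + 1) ≠ 0 := by exact_mod_cast Nat.succ_ne_zero k
    rw [negBinCoeff]; push_cast; field_simp
  rw [sub_mul, one_mul, mul_assoc, map_sub, coeff_C_mul, coeff_C_mul]
  cases n with
  | zero =>
    rw [coeff_zero_X_mul]
    have := key 0
    simp [negBinSeries, PowerSeries.coeff_derivative] at this ⊢
    rw [this]; ring
  | succ n =>
    rw [coeff_succ_X_mul]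
    have := key (n + 1)
    simp only [negBinSeries, PowerSeries.coeff_derivative, coeff_mk]
    push_cast at this ⊢
    linear_combination (z ^ (n + 2)) * this

open PowerSeries in
lemma negBinProd_ode (η : ℝ) (z w x : ℂ) (hzw : z * w = 1) (hx : z + w = 2 * x) :
    (1 - C (2 * x) * X + X ^ 2)
        * PowerSeries.derivative ℂ (negBinSeries η z * negBinSeries η w)
      = (C (2 * η * x) - C (2 * η : ℂ) * X) * (negBinSeries η z * negBinSeries η w) := by
  rw [Derivation.leibniz]
  simp only [smul_eq_mul]
  have h1 := negBinSeries_ode η z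
  have h2 := negBinSeries_ode η w
  have hz : (C z * C w : PowerSeries ℂ) = 1 := by rw [← map_mul, hzw, map_one]
  have hxx : (C z + C w : PowerSeries ℂ) = C (2 * x) := by rw [← map_add, hx]
  have e2 : (C (2 * η * x) : PowerSeries ℂ) = C (η : ℂ) * C (2 * x) := by
    rw [← map_mul]; congr 1; ring
  have e3 : (C (2 * η : ℂ) : PowerSeries ℂ) = C (η : ℂ) * 2 := by
    rw [map_mul, mul_comm]; rfl
  rw [e2, e3, ← hxx]
  rw [map_mul] at h1 h2
  set A := negBinSeries η z
  set B := negBinSeries η w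
  linear_combination (1 - C w * X) * B * h1 + (1 - C z * X) * A * h2
    - (X ^ 2 * (A * (PowerSeries.derivative ℂ) B + B * (PowerSeries.derivative ℂ) A)
      + 2 * C (η : ℂ) * X * A * B) * hz

open PowerSeries in
lemma negBinProd_coeff (η : ℝ) (z w : ℂ) (x : ℝ) (hzw : z * w = 1) (hx : z + w = 2 * x) (n : ℕ) :
    coeff n (negBinSeries η z * negBinSeries η w) = (gegen η n x : ℂ) := by
  have h := negBinProd_ode η z w x hzw hx
  set F := negBinSeries η z * negBinSeries η w with hF
  have h0 : coeff 0 F = 1 := by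
    simp [hF, coeff_mul, negBinSeries, negBinCoeff]
  have hexp : ∀ n, coeff n ((1 - C (2 * (x : ℂ)) * X + X ^ 2) * PowerSeries.derivative ℂ F)
      = coeff n ((C (2 * η * x : ℂ) - C (2 * η : ℂ) * X) * F) := fun n => by rw [h]
  have r1 : (1 - C (2 * (x : ℂ)) * X + X ^ 2) * PowerSeries.derivative ℂ F
      = PowerSeries.derivative ℂ F - C (2 * (x : ℂ)) * (X * PowerSeries.derivative ℂ F)
        + X * (X * PowerSeries.derivative ℂ F) := by ring
  have r2 : (C (2 * η * x : ℂ) - C (2 * η : ℂ) * X) * F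
      = C (2 * η * x : ℂ) * F - C (2 * η : ℂ) * (X * F) := by ring
  rw [r1, r2] at hexp
  simp only [map_add, map_sub, coeff_C_mul] at hexp
  induction n using Nat.twoStepInduction with
  | zero => rw [h0]; simp [gegen]
  | one =>
    have := hexp 0
    simp only [coeff_zero_X_mul, PowerSeries.coeff_derivative, h0] at this
    simp only [gegen]
    push_cast
    simp at this
    exact this
  | more n ih1 ih2 =>
    have := hexp (n + 1)
    rw [coeff_succ_X_mul, coeff_succ_X_mul, coeff_succ_X_mul] at this
    have hn : ((n : ℂ) + 2) ≠ 0 := by exact_mod_cast Nat.succ_ne_zero (n + 1)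
    simp only [gegen]
    push_cast
    rw [← ih1, ← ih2, eq_div_iff hn]
    cases n with
    | zero =>
      simp only [coeff_zero_X_mul, PowerSeries.coeff_derivative] at this
      push_cast at this ⊢
      linear_combination this
    | succ n =>
      simp only [coeff_succ_X_mul, PowerSeries.coeff_derivative] at this
      push_cast at this ⊢
      linear_combination this

lemma gegen_abs_le (η : ℝ) (hη : 0 ≤ η) (θ : ℝ) (n : ℕ) :
    |gegen η n (Real.cos θ)| ≤ gegen η n 1 := by
  have h1 := negBinProd_coeff η (Complex.exp (θ * Complex.I)) (Complex.exp (-θ * Complex.I))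
    (Real.cos θ) (by rw [← Complex.exp_add]; simp) (by
      rw [Complex.ofReal_cos, Complex.cos]; ring) n
  have h2 := negBinProd_coeff η 1 1 1 (by simp) (by norm_num) n
  rw [PowerSeries.coeff_mul] at h1 h2
  simp only [negBinSeries, PowerSeries.coeff_mk, one_pow, mul_one] at h1 h2
  have h2' : ∑ p ∈ Finset.HasAntidiagonal.antidiagonal n, negBinCoeff η p.1 * negBinCoeff η p.2
      = gegen η n 1 := by exact_mod_cast h2
  rw [← h2', ← Real.norm_eq_abs, ← Complex.norm_real, ← h1]
  refine (norm_sum_le _ _).trans (Finset.sum_le_sum fun p _ => ?_)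
  have e1 : ‖Complex.exp (θ * Complex.I)‖ = 1 := Complex.norm_exp_ofReal_mul_I θ
  have e2 : ‖Complex.exp (-θ * Complex.I)‖ = 1 := by
    have := Complex.norm_exp_ofReal_mul_I (-θ)
    simpa using this
  rw [norm_mul, norm_mul, norm_mul, norm_pow, norm_pow, e1, e2]
  simp only [one_pow, mul_one, Complex.norm_real, Real.norm_eq_abs]
  rw [abs_of_nonneg (negBinCoeff_nonneg η hη _), abs_of_nonneg (negBinCoeff_nonneg η hη _)]

lemma gegen_one_succ (η : ℝ) (n : ℕ) :
    ((n : ℝ) + 1) * gegen η (n + 1) 1 = (n + 2 * η) * gegen η n 1 := by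
  induction n with
  | zero => simp [gegen]
  | succ n ih =>
    have hn : ((n : ℝ) + 2) ≠ 0 := by positivity
    rw [gegen]
    push_cast
    field_simp
    linear_combination ((n : ℝ) + 2) * ih

lemma gegen_one_bound (d : ℕ) (hd : 2 ≤ d) (n : ℕ) :
    0 ≤ gegen (etaD d) n 1 ∧ gegen (etaD d) n 1 ≤ ((n : ℝ) + 1) ^ (d - 2) := by
  obtain ⟨e, rfl⟩ : ∃ e, d = e + 2 := ⟨d - 2, by omega⟩
  have h2 : 2 * etaD (e + 2) = (e : ℝ) + 1 := by rw [etaD]; push_cast; ring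
  simp only [Nat.add_sub_cancel]
  induction n with
  | zero => simp [gegen]
  | succ n ih =>
    obtain ⟨i0, i1⟩ := ih
    have hs := gegen_one_succ (etaD (e + 2)) n
    rw [h2] at hs
    have hn : (0 : ℝ) < (n : ℝ) + 1 := by positivity
    have hs' : gegen (etaD (e + 2)) (n + 1) 1
        = (1 + e * (1 / ((n : ℝ) + 1))) * gegen (etaD (e + 2)) n 1 := by
      field_simp
      linear_combination hs
    have hb : 1 + (e : ℝ) * (1 / ((n : ℝ) + 1)) ≤ (1 + 1 / ((n : ℝ) + 1)) ^ e :=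
      one_add_mul_le_pow (by have : 0 < 1 / ((n : ℝ) + 1) := by positivity
                             linarith) e
    constructor
    · rw [hs']; positivity
    · rw [hs']
      calc _ ≤ (1 + 1 / ((n : ℝ) + 1)) ^ e * ((n : ℝ) + 1) ^ e := by gcongr
        _ = _ := by
          rw [← mul_pow]; congr 1; push_cast; field_simp

lemma Zker_bound (d : ℕ) (hd : 2 ≤ d) : ∃ C : ℝ, 0 ≤ C ∧ ∀ (ℓ : ℕ) (θ : ℝ),
    |Zker d ℓ (Real.cos θ)| ≤ C * ((ℓ : ℝ) + 1) ^ (d - 1) := by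
  have hη : 0 ≤ etaD d := by
    rw [etaD]
    have : (2 : ℝ) ≤ d := by exact_mod_cast hd
    linarith
  refine ⟨(1 + etaD d) * |(etaD d * omegaD d)⁻¹|, by positivity, fun ℓ θ => ?_⟩
  have h1 := (gegen_abs_le (etaD d) hη θ ℓ).trans (gegen_one_bound d hd ℓ).2
  rw [Zker, abs_mul, div_eq_mul_inv, abs_mul, abs_of_nonneg (by positivity : 0 ≤ (ℓ : ℝ) + etaD d)]
  have h2 : (ℓ : ℝ) + etaD d ≤ (1 + etaD d) * ((ℓ : ℝ) + 1) := by
    nlinarith [(Nat.cast_nonneg ℓ : (0 : ℝ) ≤ ℓ)]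
  have e : d - 1 = (d - 2) + 1 := by omega
  rw [e, pow_succ]
  calc _ ≤ (1 + etaD d) * ((ℓ : ℝ) + 1) * |(etaD d * omegaD d)⁻¹| * ((ℓ : ℝ) + 1) ^ (d - 2) := by
        gcongr
    _ = _ := by ring

/-- Backward shift (with value `0` at `0`). -/
def bshift (g : ℕ → ℝ) : ℕ → ℝ
  | 0 => 0
  | (n + 1) => g n

/-- `p ℓ = 1/(ℓ+η)`. -/
def pinv (η : ℝ) : ℕ → ℝ := fun ℓ => 1 / ((ℓ : ℝ) + η)

/-- The operator `Υ` written with shifts. -/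
def upsOp (η : ℝ) (r : ℕ → ℝ) : ℕ → ℝ := fun ℓ =>
  (1 / 2 + (-η / 2) * pinv η ℓ) * bshift (deltaPlus (deltaPlus r)) ℓ
    + (η * pinv η ℓ) * deltaPlus r ℓ

/-- The weight `max (1/(ℓ+1)) (1/h)`. -/
def wt (h : ℝ) (ℓ : ℕ) : ℝ := max (1 / ((ℓ : ℝ) + 1)) (1 / h)

lemma wt_pos (h : ℝ) (ℓ : ℕ) : 0 < wt h ℓ :=
  lt_max_of_lt_left (by positivity)

lemma wt_anti (h : ℝ) (ℓ : ℕ) : wt h (ℓ + 1) ≤ wt h ℓ := by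
  unfold wt
  refine max_le_max ?_ le_rfl
  push_cast
  gcongr
  linarith

lemma wt_succ (h : ℝ) (hh : 0 < h) (ℓ : ℕ) : wt h ℓ ≤ 2 * wt h (ℓ + 1) := by
  unfold wt
  have hp : 0 < 1 / h := by positivity
  refine max_le ?_ ?_
  · have : 1 / ((ℓ : ℝ) + 1) ≤ 2 * (1 / (((ℓ + 1 : ℕ) : ℝ) + 1)) := by
      push_cast
      rw [mul_one_div, div_le_div_iff₀ (by positivity) (by positivity)]
      linarith [(Nat.cast_nonneg ℓ : (0 : ℝ) ≤ ℓ)]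
    exact this.trans (by gcongr; exact le_max_left _ _)
  · have : 1 / h ≤ max (1 / (((ℓ + 1 : ℕ) : ℝ) + 1)) (1 / h) := le_max_right _ _
    linarith

lemma one_le_wt_zero (h : ℝ) : 1 ≤ wt h 0 := by
  unfold wt; exact le_max_of_le_left (by norm_num)

/-- Uniform bound of order `k`. -/
def Bd (h : ℕ → ℝ) (k : ℕ) (f : ℕ → ℕ → ℝ) : Prop :=
  ∃ C : ℝ, 0 ≤ C ∧ ∀ j ℓ, |f j ℓ| ≤ C * wt (h j) ℓ ^ k

/-- Symbol class: `N` differences, order `k`. -/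
def SymC (h : ℕ → ℝ) : ℕ → ℕ → (ℕ → ℕ → ℝ) → Prop
  | 0, k, f => Bd h k f
  | (N + 1), k, f => Bd h k f ∧ SymC h N (k + 1) (fun j => deltaPlus (f j))

lemma SymC.bd {h : ℕ → ℝ} {N k : ℕ} {f : ℕ → ℕ → ℝ} (hf : SymC h N k f) : Bd h k f := by
  cases N with
  | zero => exact hf
  | succ N => exact hf.1

lemma SymC.mono {h : ℕ → ℝ} {N k : ℕ} {f : ℕ → ℕ → ℝ} (hf : SymC h (N + 1) k f) : SymC h N k f := by
  induction N generalizing k f with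
  | zero => exact hf.1
  | succ N ih => exact ⟨hf.1, ih hf.2⟩

lemma Bd.add {h : ℕ → ℝ} {k : ℕ} {f g : ℕ → ℕ → ℝ} (hf : Bd h k f) (hg : Bd h k g) :
    Bd h k (fun j ℓ => f j ℓ + g j ℓ) := by
  obtain ⟨C, hC, hf⟩ := hf
  obtain ⟨D, hD, hg⟩ := hg
  refine ⟨C + D, by positivity, fun j ℓ => ?_⟩
  rw [add_mul]
  exact (abs_add_le _ _).trans (add_le_add (hf j ℓ) (hg j ℓ))

lemma Bd.mul {h : ℕ → ℝ} {k k' : ℕ} {f g : ℕ → ℕ → ℝ} (hf : Bd h k f) (hg : Bd h k' g) :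
    Bd h (k + k') (fun j ℓ => f j ℓ * g j ℓ) := by
  obtain ⟨C, hC, hf⟩ := hf
  obtain ⟨D, hD, hg⟩ := hg
  refine ⟨C * D, by positivity, fun j ℓ => ?_⟩
  have := wt_pos (h j) ℓ
  calc |f j ℓ * g j ℓ| = |f j ℓ| * |g j ℓ| := abs_mul _ _
    _ ≤ (C * wt (h j) ℓ ^ k) * (D * wt (h j) ℓ ^ k') :=
      mul_le_mul (hf j ℓ) (hg j ℓ) (abs_nonneg _) (by positivity)
    _ = _ := by rw [pow_add]; ring

lemma SymC.add {h : ℕ → ℝ} {N k : ℕ} {f g : ℕ → ℕ → ℝ} (hf : SymC h N k f) (hg : SymC h N k g) :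
    SymC h N k (fun j ℓ => f j ℓ + g j ℓ) := by
  induction N generalizing k f g with
  | zero => exact Bd.add hf hg
  | succ N ih =>
    refine ⟨hf.1.add hg.1, ?_⟩
    convert ih hf.2 hg.2 using 3
    simp only [deltaPlus]; ring

lemma SymC.zero (h : ℕ → ℝ) (N k : ℕ) : SymC h N k (fun _ _ => 0) := by
  have hb : ∀ k, Bd h k (fun _ _ => 0) := fun k => ⟨0, le_rfl, fun j ℓ => by simp⟩
  induction N generalizing k with
  | zero => exact hb k
  | succ N ih =>
    refine ⟨hb k, ?_⟩
    convert ih (k + 1) using 3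
    simp [deltaPlus]

lemma SymC.const (h : ℕ → ℝ) (N : ℕ) (c : ℝ) : SymC h N 0 (fun _ _ => c) := by
  have hb : Bd h 0 (fun _ _ => c) := ⟨|c|, abs_nonneg _, fun j ℓ => by simp⟩
  cases N with
  | zero => exact hb
  | succ N =>
    refine ⟨hb, ?_⟩
    convert SymC.zero h N 1 using 3
    simp [deltaPlus]

lemma SymC.shift {h : ℕ → ℝ} {N k : ℕ} {f : ℕ → ℕ → ℝ} (hf : SymC h N k f) :
    SymC h N k (fun j ℓ => f j (ℓ + 1)) := by
  have hb : ∀ {k f}, Bd h k f → Bd h k (fun j ℓ => f j (ℓ + 1)) := by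
    rintro k f ⟨C, hC, hf⟩
    refine ⟨C, hC, fun j ℓ => (hf j (ℓ + 1)).trans ?_⟩
    have := wt_anti (h j) ℓ
    have := wt_pos (h j) (ℓ + 1)
    gcongr
  induction N generalizing k f with
  | zero => exact hb hf
  | succ N ih => exact ⟨hb hf.1, ih hf.2⟩

lemma SymC.mul {h : ℕ → ℝ} {N k k' : ℕ} {f g : ℕ → ℕ → ℝ} (hf : SymC h N k f)
    (hg : SymC h N k' g) : SymC h N (k + k') (fun j ℓ => f j ℓ * g j ℓ) := by
  induction N generalizing k k' f g with
  | zero => exact Bd.mul hf hg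
  | succ N ih =>
    refine ⟨hf.1.mul hg.1, ?_⟩
    have h1 := ih hf.2 hg.mono.shift
    have h2 := ih hf.mono hg.2
    rw [show k + 1 + k' = k + k' + 1 by ring] at h1
    convert h1.add h2 using 3
    simp only [deltaPlus]; ring

lemma SymC.bshift_single {h : ℕ → ℝ} (N k : ℕ) {c : ℕ → ℝ} {B : ℝ} {m : ℕ}
    (hc : ∀ j, |c j| ≤ B * wt (h j) 0 ^ m) (hB : 0 ≤ B) (hmk : m ≤ k) :
    SymC h N k (fun j ℓ => if ℓ = 0 then c j else 0) := by
  have hb : ∀ (k : ℕ) (c : ℕ → ℝ), m ≤ k → (∀ j, |c j| ≤ B * wt (h j) 0 ^ m) →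
      Bd h k (fun j ℓ => if ℓ = 0 then c j else 0) := by
    intro k c hk hc
    refine ⟨B, hB, fun j ℓ => ?_⟩
    have := wt_pos (h j) ℓ
    dsimp only
    split_ifs with hl
    · subst hl
      exact (hc j).trans (mul_le_mul_of_nonneg_left
        (pow_le_pow_right₀ (one_le_wt_zero _) hk) hB)
    · simp; positivity
  induction N generalizing k c with
  | zero => exact hb k c hmk hc
  | succ N ih =>
    refine ⟨hb k c hmk hc, ?_⟩
    convert ih (k + 1) (c := fun j => - c j) (fun j => by rw [abs_neg]; exact hc j) (by omega)
      using 3 with j ℓ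
    simp only [deltaPlus]
    by_cases hl : ℓ = 0 <;> simp [hl]

lemma SymC.bshift {h : ℕ → ℝ} (hh : ∀ j, 0 < h j) {N k : ℕ} {f : ℕ → ℕ → ℝ}
    (hf : SymC h N k f) : SymC h N k (fun j => bshift (f j)) := by
  have hb : ∀ {k f}, Bd h k f → Bd h k (fun j => _root_.bshift (f j)) := by
    rintro k f ⟨C, hC, hf⟩
    refine ⟨C * 2 ^ k, by positivity, fun j ℓ => ?_⟩
    have h0 := wt_pos (h j) ℓ
    cases ℓ with
    | zero => simp only [_root_.bshift, abs_zero]; positivity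
    | succ ℓ =>
      simp only [_root_.bshift]
      refine (hf j ℓ).trans ?_
      rw [mul_assoc, ← mul_pow]
      have := wt_succ (h j) (hh j) ℓ
      have := wt_pos (h j) ℓ
      gcongr
  induction N generalizing k f with
  | zero => exact hb hf
  | succ N ih =>
    refine ⟨hb hf.1, ?_⟩
    obtain ⟨C, hC, hfC⟩ := hf.1
    have h1 : SymC h N (k + 1) (fun j ℓ => if ℓ = 0 then f j 0 else 0) :=
      SymC.bshift_single N (k + 1) (fun j => hfC j 0) hC (Nat.le_succ k)
    convert (ih hf.2).add h1 using 3 with j ℓ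
    cases ℓ with
    | zero => simp [deltaPlus, _root_.bshift]
    | succ ℓ => simp [deltaPlus, _root_.bshift]

lemma SymC.pinv (h : ℕ → ℝ) (N : ℕ) {η : ℝ} (hη : 0 < η) : SymC h N 1 (fun _ => pinv η) := by
  have hb : Bd h 1 (fun _ => _root_.pinv η) := by
    refine ⟨1 + 1 / η, by positivity, fun j ℓ => ?_⟩
    have h1 : 1 / ((ℓ : ℝ) + 1) ≤ wt (h j) ℓ := le_max_left _ _
    have h2 : 0 < (ℓ : ℝ) + η := by positivity
    simp only [_root_.pinv]; rw [abs_of_pos (by positivity), pow_one]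
    refine le_trans ?_ (mul_le_mul_of_nonneg_left h1 (by positivity))
    rw [div_le_iff₀ h2]
    have : (1 + 1 / η) * (1 / ((ℓ : ℝ) + 1)) * ((ℓ : ℝ) + η)
      = (ℓ + 1 + η + ℓ / η) / ((ℓ : ℝ) + 1) := by field_simp; ring
    rw [this, le_div_iff₀ (by positivity)]
    have : 0 ≤ (ℓ : ℝ) / η := by positivity
    linarith
  induction N with
  | zero => exact hb
  | succ N ih =>
    refine ⟨hb, ?_⟩
    have h1 := (SymC.const h N (-1)).mul (ih.mul ih.shift)
    convert h1 using 3 with j ℓ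
    simp only [deltaPlus, _root_.pinv]
    have h2 : (ℓ : ℝ) + η ≠ 0 := by positivity
    have h3 : ((ℓ + 1 : ℕ) : ℝ) + η ≠ 0 := by positivity
    field_simp
    push_cast
    ring

lemma SymC.upsOp {h : ℕ → ℝ} (hh : ∀ j, 0 < h j) {η : ℝ} (hη : 0 < η) {N k : ℕ}
    {f : ℕ → ℕ → ℝ} (hf : SymC h (N + 2) k f) : SymC h N (k + 2) (fun j => upsOp η (f j)) := by
  have hp := SymC.pinv h N hη
  have hp0 : SymC h N 0 (fun _ => _root_.pinv η) := by
    have hw : Bd h 0 (fun _ => _root_.pinv η) := by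
      refine ⟨1 / η, by positivity, fun j ℓ => ?_⟩
      have h2 : 0 < (ℓ : ℝ) + η := by positivity
      simp only [_root_.pinv]; rw [abs_of_pos (by positivity), pow_zero, mul_one]
      gcongr
      simp
    cases N with
    | zero => exact hw
    | succ N =>
      refine ⟨hw, ?_⟩
      have hq := (SymC.pinv h N hη)
      have hb : SymC h N (0 + 1) (fun j ℓ => _root_.pinv η ℓ) := hq
      have h2 : SymC h N 1 (fun _ ℓ => _root_.pinv η (ℓ + 1)) := hq.shift
      have h3 := (SymC.const h N (-1)).mul hq
      convert h2.add h3 using 3 with j ℓ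
      simp only [deltaPlus]; ring
  have hu := (SymC.const h N (1 / 2)).add ((SymC.const h N (-η / 2)).mul hp0)
  have hv := (SymC.const h N η).mul hp
  have h2 := SymC.bshift hh hf.2.2
  have h1 := hf.2.mono
  have A := hu.mul h2
  have B := hv.mul h1
  rw [show 0 + (k + 1 + 1) = k + 2 by ring] at A
  rw [show 0 + 1 + (k + 1) = k + 2 by ring] at B
  exact A.add B

lemma SymC.upsOp_iter {h : ℕ → ℝ} (hh : ∀ j, 0 < h j) {η : ℝ} (hη : 0 < η)
    {f : ℕ → ℕ → ℝ} (hf : ∀ N, SymC h N 0 f) (M N : ℕ) :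
    SymC h N (2 * M) (fun j => (_root_.upsOp η)^[M] (f j)) := by
  induction M generalizing N with
  | zero => exact hf N
  | succ M ih =>
    simp only [Function.iterate_succ', Function.comp]
    exact SymC.upsOp hh hη (ih (N + 2))

lemma SymC.of_smooth {h : ℕ → ℝ} (hh : ∀ j, 0 < h j) (N k : ℕ) (F : ℕ → ℝ → ℝ)
    (hF : ∀ j, ContDiff ℝ (⊤ : ℕ∞) (F j)) (C : ℕ → ℝ)
    (hC : ∀ n j u, |iteratedDeriv n (F j) u| ≤ C n / h j ^ (n + k)) :
    SymC h N k (fun j ℓ => F j (ℓ : ℝ)) := by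
  have hCn : ∀ n, 0 ≤ C n := by
    intro n
    have h0 := (abs_nonneg _).trans (hC n 0 0)
    have h1 : 0 < h 0 ^ (n + k) := pow_pos (hh 0) _
    by_contra hneg
    push Not at hneg
    exact absurd h0 (not_le.mpr (div_neg_of_neg_of_pos hneg h1))
  have hb : Bd h k (fun j ℓ => F j (ℓ : ℝ)) := by
    refine ⟨C 0, hCn 0, fun j ℓ => ?_⟩
    have h0 := hC 0 j ℓ
    rw [iteratedDeriv_zero, zero_add] at h0
    refine h0.trans ?_
    rw [div_eq_mul_inv, ← inv_pow, ← one_div]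
    have : 1 / h j ≤ wt (h j) ℓ := le_max_right _ _
    have := hh j
    have := hCn 0
    gcongr
  induction N generalizing k F C with
  | zero => exact hb
  | succ N ih =>
    refine ⟨hb, ?_⟩
    have hG : ∀ j, ContDiff ℝ (⊤ : ℕ∞) (fun u => F j (u + 1)) := fun j =>
      (hF j).comp (contDiff_id.add contDiff_const)
    have hder : ∀ n j u, |iteratedDeriv n (fun u => F j (u + 1) - F j u) u|
        ≤ C (n + 1) / h j ^ (n + (k + 1)) := by
      intro n j u
      have e : iteratedDeriv n (fun u => F j (u + 1) - F j u) u
          = iteratedDeriv n (F j) (u + 1) - iteratedDeriv n (F j) u := by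
        rw [iteratedDeriv_fun_sub ((hG j).contDiffAt.of_le (by exact_mod_cast le_top))
          ((hF j).contDiffAt.of_le (by exact_mod_cast le_top))]
        rw [iteratedDeriv_comp_add_const]
      rw [e]
      have hd : Differentiable ℝ (iteratedDeriv n (F j)) :=
        (hF j).differentiable_iteratedDeriv n (by exact_mod_cast ENat.natCast_lt_top n)
      have := Convex.norm_image_sub_le_of_norm_deriv_le (f := iteratedDeriv n (F j))
        (s := Set.univ) (x := u) (y := u + 1) (C := C (n + 1) / h j ^ (n + (k + 1)))
        (fun x _ => hd x) (fun x _ => by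
          rw [← iteratedDeriv_succ]
          have := hC (n + 1) j x
          rwa [show n + 1 + k = n + (k + 1) by ring] at this)
        convex_univ (Set.mem_univ _) (Set.mem_univ _)
      simpa using this
    have h1 := ih (k + 1) (fun j u => F j (u + 1) - F j u) (fun j => (hG j).sub (hF j))
      (fun n => C (n + 1)) hder
    have hb' := h1 (fun n => hCn (n + 1)) (by
      refine ⟨C 1, hCn 1, fun j ℓ => ?_⟩
      have h0 := hder 0 j ℓ
      simp only [iteratedDeriv_zero, zero_add] at h0
      refine h0.trans ?_
      rw [div_eq_mul_inv, ← inv_pow, ← one_div]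
      have : 1 / h j ≤ wt (h j) ℓ := le_max_right _ _
      have := hh j
      have := hCn 1
      gcongr)
    convert hb' using 3 with j ℓ
    simp [deltaPlus]

lemma upsOp_eq {η : ℝ} (hη : 0 < η) (r : ℕ → ℝ) (ℓ : ℕ) :
    2 * ((ℓ : ℝ) + η) * upsOp η r ℓ
      = ℓ * bshift (deltaPlus (deltaPlus r)) ℓ + 2 * η * deltaPlus r ℓ := by
  have : (ℓ : ℝ) + η ≠ 0 := by positivity
  simp only [upsOp, pinv]
  field_simp
  ring

lemma gegen_rec (η x : ℝ) (n : ℕ) :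
    ((n : ℝ) + 2) * gegen η (n + 2) x
      = 2 * ((n : ℝ) + 1 + η) * x * gegen η (n + 1) x - ((n : ℝ) + 2 * η) * gegen η n x := by
  have hn : ((n : ℝ) + 2) ≠ 0 := by positivity
  rw [gegen]
  field_simp
  ring

lemma abel_gegen {η : ℝ} (hη : 0 < η) (x : ℝ) (r : ℕ → ℝ) (n : ℕ) :
    (x - 1) * ∑ ℓ ∈ Finset.range (n + 1), r ℓ * (2 * ((ℓ : ℝ) + η) * gegen η ℓ x)
      = ∑ ℓ ∈ Finset.range (n + 1), upsOp η r ℓ * (2 * ((ℓ : ℝ) + η) * gegen η ℓ x)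
        + (r n * (n + 1) * gegen η (n + 1) x - (n + 2 * η) * r (n + 1) * gegen η n x) := by
  induction n with
  | zero =>
    have h := upsOp_eq hη r 0
    simp only [zero_add, Finset.sum_range_one, gegen, deltaPlus, Nat.cast_zero] at h ⊢
    linear_combination -h
  | succ n ih =>
    have h := upsOp_eq hη r (n + 1)
    have hg := gegen_rec η x n
    rw [Finset.sum_range_succ, mul_add, ih, Finset.sum_range_succ _ (n + 1)]
    simp only [bshift, deltaPlus] at h
    push_cast at h ⊢
    linear_combination (-gegen η (n + 1) x) * h - r (n + 1) * hg

lemma abel_Zker (d : ℕ) (hd : 2 ≤ d) (x : ℝ) (r : ℕ → ℝ) (n : ℕ) (h0 : r n = 0)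
    (h1 : r (n + 1) = 0) :
    (x - 1) * ∑ ℓ ∈ Finset.range (n + 1), r ℓ * Zker d ℓ x
      = ∑ ℓ ∈ Finset.range (n + 1), upsOp (etaD d) r ℓ * Zker d ℓ x := by
  have hη : 0 < etaD d := by
    rw [etaD]
    have : (2 : ℝ) ≤ d := by exact_mod_cast hd
    linarith
  have h := abel_gegen hη x r n
  rw [h0, h1] at h
  have hz : ∀ ℓ, Zker d ℓ x = (1 / (2 * (etaD d * omegaD d)))
      * (2 * ((ℓ : ℝ) + etaD d) * gegen (etaD d) ℓ x) := by
    intro ℓ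
    rw [Zker, one_div, mul_inv, div_eq_mul_inv]; ring
  simp only [hz, mul_left_comm _ (1 / (2 * (etaD d * omegaD d))), ← Finset.mul_sum]
  rw [h]; ring

lemma upsOp_zero_of (η : ℝ) (r : ℕ → ℝ) (ℓ : ℕ) (hm : ∀ k, ℓ ≤ k + 1 → k ≤ ℓ + 1 → r k = 0) :
    upsOp η r ℓ = 0 := by
  cases ℓ with
  | zero => simp [upsOp, bshift, deltaPlus, hm 0 (by omega) (by omega), hm 1 (by omega) (by omega)]
  | succ n =>
    simp [upsOp, bshift, deltaPlus, hm n (by omega) (by omega), hm (n + 1) (by omega) (by omega),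
      hm (n + 1 + 1) (by omega) (by omega)]

lemma upsOp_iter_zero (η : ℝ) (r : ℕ → ℝ) (M ℓ : ℕ)
    (hm : ∀ k, ℓ ≤ k + M → k ≤ ℓ + M → r k = 0) : (upsOp η)^[M] r ℓ = 0 := by
  induction M generalizing ℓ with
  | zero => exact hm ℓ (by omega) (by omega)
  | succ M ih =>
    rw [Function.iterate_succ', Function.comp]
    exact upsOp_zero_of _ _ _ fun k h1 h2 => ih k fun i h3 h4 => hm i (by omega) (by omega)

lemma abel_iter (d : ℕ) (hd : 2 ≤ d) (x : ℝ) (r : ℕ → ℝ) (A n M : ℕ)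
    (hr : ∀ k, A ≤ k → r k = 0) (hn : A + M ≤ n) :
    (x - 1) ^ M * ∑ ℓ ∈ Finset.range (n + 1), r ℓ * Zker d ℓ x
      = ∑ ℓ ∈ Finset.range (n + 1), (upsOp (etaD d))^[M] r ℓ * Zker d ℓ x := by
  induction M with
  | zero => simp
  | succ M ih =>
    rw [pow_succ', mul_assoc, ih (by omega), Function.iterate_succ']
    exact abel_Zker d hd x _ n
      (upsOp_iter_zero _ _ _ _ fun k h1 _ => hr k (by omega))
      (upsOp_iter_zero _ _ _ _ fun k h1 _ => hr k (by omega))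

/-- **Localization proposition with a discrete-difference hypothesis.**
If moreover `|(Δ⁻)^M (Δ⁺)^M b_j(ℓ)| ≤ C_M/(S_j − S_{j−1})^{2M}` for all `ℓ, j`,
then `|(cos θ − 1)^M Ψ_j(cos θ)| ≤ C'_M (S_{j+1}^d − S_{j−1}^d) ·
max{1/S_{j−1}^{2M}, 1/(S_j − S_{j−1})^{2M}}`, where
`Ψ_j(cos θ) = Σ_{ℓ ∈ [S_{j−1}, S_{j+1}]} b_j(ℓ) Z_{ℓ;d}(cos θ)`. -/
theorem flexible_needlet_localization_aux
    (d : ℕ) (hd : 2 ≤ d) (S : ℕ → ℝ) (b : ℕ → ℝ → ℝ) (K : ℕ → ℝ)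
    (M : ℕ) (CM : ℝ) (hCM : 0 < CM)
    -- scale sequence assumptions
    (hS0 : S 0 = 1) (hSpos : ∀ j, 0 < S j) (hSmono : StrictMono S)
    (hStop : Filter.Tendsto S Filter.atTop Filter.atTop)
    (hSconv : ∀ j : ℕ, S (j + 1) - S j ≤ S (j + 2) - S (j + 1))
    -- kernel sequence assumptions
    (hbC : ∀ j, ContDiff ℝ (⊤ : ℕ∞) (b j))
    (hb01 : ∀ j, ∀ u : ℝ, 0 ≤ u → b j u ∈ Set.Icc (0 : ℝ) 1)
    (hbderiv : ∀ j n : ℕ, 1 ≤ j → 1 ≤ n →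
      ∀ u : ℝ, |iteratedDeriv n (b j) u| ≤ K n / (S j - S (j - 1)) ^ n)
    (hbsupp : ∀ j : ℕ, 1 ≤ j → ∀ u : ℝ, (u < S (j - 1) ∨ S (j + 1) < u) → b j u = 0)
    (hbval : ∀ j : ℕ, 1 ≤ j →
      b j (S (j - 1)) = 0 ∧ b j (S (j + 1)) = 0 ∧ b j (S j) = 1)
    (hbpart : ∀ u : ℝ, 1 ≤ u → ∑' j : ℕ, (b j u) ^ 2 = 1)
    -- discrete-difference hypothesis
    (hdiff : ∀ j : ℕ, 1 ≤ j → ∀ ℓ : ℕ,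
      |(deltaMinus^[M] (deltaPlus^[M] (fun m : ℕ => b j (m : ℝ)))) ℓ| ≤
        CM / (S j - S (j - 1)) ^ (2 * M)) :
    ∃ C : ℝ, 0 < C ∧
      ∀ j : ℕ, 1 ≤ j → ∀ θ : ℝ, 0 < θ → θ ≤ Real.pi →
        |(Real.cos θ - 1) ^ M *
            ∑' ℓ : ℕ, (if S (j - 1) ≤ (ℓ : ℝ) ∧ (ℓ : ℝ) ≤ S (j + 1) then
              b j (ℓ : ℝ) * Zker d ℓ (Real.cos θ) else 0)| ≤
          C * (S (j + 1) ^ d - S (j - 1) ^ d) *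
            max (1 / S (j - 1) ^ (2 * M)) (1 / (S j - S (j - 1)) ^ (2 * M)) := by
  have hη : 0 < etaD d := by
    rw [etaD]
    have : (2 : ℝ) ≤ d := by exact_mod_cast hd
    linarith
  set h : ℕ → ℝ := fun j => S (j + 1) - S j with hdef
  have hh : ∀ j, 0 < h j := fun j => sub_pos.mpr (hSmono (Nat.lt_succ_self j))
  have hmonoh : ∀ j, h 0 ≤ h j := by
    intro j
    induction j with
    | zero => exact le_rfl
    | succ j ih => exact ih.trans (hSconv j)
  have hS1 : ∀ j, 1 ≤ S j := fun j => hS0 ▸ hSmono.monotone (Nat.zero_le j)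
  have habs : ∀ j u, |b (j + 1) u| ≤ 1 := by
    intro j u
    rcases le_or_gt 0 u with hu | hu
    · have := hb01 (j + 1) u hu
      rw [abs_of_nonneg this.1]; exact this.2
    · rw [hbsupp (j + 1) (by omega) u (Or.inl (hu.trans (hSpos _)))]; simp
  have hsym : ∀ N, SymC h N 0 (fun j ℓ => b (j + 1) (ℓ : ℝ)) := by
    intro N
    refine SymC.of_smooth hh N 0 (fun j => b (j + 1)) (fun j => hbC _)
      (fun n => if n = 0 then 1 else K n) ?_
    intro n j u
    rcases Nat.eq_zero_or_pos n with hn | hn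
    · subst hn
      simpa using habs j u
    · have := hbderiv (j + 1) n (by omega) hn u
      simpa [hn.ne', hdef] using this
  obtain ⟨C1, hC1, hT⟩ := (SymC.upsOp_iter hh hη hsym M 0).bd
  obtain ⟨C2, hC2, hZ⟩ := Zker_bound d hd
  have h00 := hh 0
  refine ⟨(C1 * ((M : ℝ) + 1) ^ (2 * M)) * (C2 * ((M : ℝ) + 3) ^ (d - 1))
    * (1 + (2 * M + 3) / h 0) + 1, by positivity, ?_⟩
  intro j hj θ _ _
  obtain ⟨i, rfl⟩ : ∃ i, j = i + 1 := ⟨j - 1, by omega⟩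
  simp only [Nat.add_sub_cancel]
  set s := S i with hs
  set t := S (i + 2) with ht
  have hst : h 0 ≤ t - s := by
    have h1 : S (i + 1) ≤ t := hSmono.monotone (by omega)
    have h2 : h 0 ≤ S (i + 1) - s := hmonoh i
    linarith
  have hs1 : 1 ≤ s := hS1 i
  have ht1 : 1 ≤ t := hS1 (i + 2)
  set r : ℕ → ℝ := fun ℓ => b (i + 1) (ℓ : ℝ) with hr
  have hrlow : ∀ k : ℕ, (k : ℝ) < s → r k = 0 := fun k hk =>
    hbsupp (i + 1) (by omega) k (Or.inl hk)
  have hrhigh : ∀ k : ℕ, t < (k : ℝ) → r k = 0 := fun k hk =>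
    hbsupp (i + 1) (by omega) k (Or.inr hk)
  set A := ⌊t⌋₊ + 1 with hA
  have hrA : ∀ k, A ≤ k → r k = 0 := by
    intro k hk
    exact hrhigh k ((Nat.floor_lt (by linarith)).1 (by omega))
  set n := A + M with hn
  have htsum : ∑' ℓ : ℕ, (if s ≤ (ℓ : ℝ) ∧ (ℓ : ℝ) ≤ S (i + 1 + 1) then
      b (i + 1) (ℓ : ℝ) * Zker d ℓ (Real.cos θ) else 0)
      = ∑ ℓ ∈ Finset.range (n + 1), r ℓ * Zker d ℓ (Real.cos θ) := by
    have e : ∀ ℓ : ℕ, (if s ≤ (ℓ : ℝ) ∧ (ℓ : ℝ) ≤ S (i + 1 + 1) then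
      b (i + 1) (ℓ : ℝ) * Zker d ℓ (Real.cos θ) else 0) = r ℓ * Zker d ℓ (Real.cos θ) := by
      intro ℓ
      split_ifs with hl
      · rfl
      · rw [not_and_or, not_le, not_le] at hl
        rcases hl with hl | hl
        · rw [hrlow ℓ hl, zero_mul]
        · rw [hrhigh ℓ hl, zero_mul]
    simp only [e]
    refine tsum_eq_sum fun ℓ hl => ?_
    rw [Finset.mem_range] at hl
    rw [hrA ℓ (by omega), zero_mul]
  rw [htsum, abel_iter d hd _ r A n M hrA le_rfl]
  set m := max (1 / s ^ (2 * M)) (1 / (S (i + 1) - s) ^ (2 * M)) with hm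
  have hm0 : 0 ≤ m := le_max_of_le_left (by positivity)
  have hhi : 0 < h i := hh i
  -- restrict the sum to the support
  have hterm : ∀ ℓ : ℕ, s ≤ (ℓ : ℝ) + M → |(upsOp (etaD d))^[M] r ℓ|
      ≤ C1 * ((M : ℝ) + 1) ^ (2 * M) * m := by
    intro ℓ hl
    refine (hT i ℓ).trans ?_
    have hw : wt (h i) ℓ ≤ ((M : ℝ) + 1) * max (1 / s) (1 / h i) := by
      refine max_le ?_ ?_
      · refine le_trans ?_ (mul_le_mul_of_nonneg_left (le_max_left _ _) (by positivity))
        rw [mul_one_div, div_le_div_iff₀ (by positivity) (by linarith)]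
        nlinarith [mul_nonneg (Nat.cast_nonneg (α := ℝ) M) (Nat.cast_nonneg (α := ℝ) ℓ)]
      · refine le_trans (le_max_right (1 / s) _) ?_
        have : 0 ≤ max (1 / s) (1 / h i) := le_max_of_le_right (by positivity)
        nlinarith [Nat.cast_nonneg (α := ℝ) M]
    have hmm : max (1 / s) (1 / h i) ^ (2 * M) ≤ m := by
      rcases max_choice (1 / s) (1 / h i) with hc | hc
      · rw [hc, one_div_pow]; exact le_max_left _ _
      · rw [hc, one_div_pow]; exact le_max_right _ _
    have hw0 := wt_pos (h i) ℓ
    calc C1 * wt (h i) ℓ ^ (2 * M)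
        ≤ C1 * (((M : ℝ) + 1) * max (1 / s) (1 / h i)) ^ (2 * M) := by gcongr
      _ = C1 * ((M : ℝ) + 1) ^ (2 * M) * max (1 / s) (1 / h i) ^ (2 * M) := by
        rw [mul_pow]; ring
      _ ≤ _ := by gcongr
  have hsupp : ∀ ℓ : ℕ, (ℓ : ℝ) + M < s → (upsOp (etaD d))^[M] r ℓ = 0 := by
    intro ℓ hl
    refine upsOp_iter_zero _ _ _ _ fun k _ h2 => hrlow k ?_
    have : (k : ℝ) ≤ ℓ + M := by exact_mod_cast h2
    linarith
  have hfl : (⌊t⌋₊ : ℝ) ≤ t := Nat.floor_le (by linarith)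
  have hsub : ∑ ℓ ∈ Finset.range (n + 1), (upsOp (etaD d))^[M] r ℓ * Zker d ℓ (Real.cos θ)
      = ∑ ℓ ∈ Finset.Ico (⌈s⌉₊ - M) (n + 1),
        (upsOp (etaD d))^[M] r ℓ * Zker d ℓ (Real.cos θ) := by
    symm
    refine Finset.sum_subset (fun ℓ hl => ?_) (fun ℓ hl hl' => ?_)
    · rw [Finset.mem_Ico] at hl
      exact Finset.mem_range.2 hl.2
    · rw [Finset.mem_range] at hl
      rw [Finset.mem_Ico, not_and_or] at hl'
      have h3 : ℓ + M < ⌈s⌉₊ := by omega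
      rw [hsupp ℓ (by exact_mod_cast Nat.lt_ceil.1 h3), zero_mul]
  rw [hsub]
  have hB : ∀ ℓ ∈ Finset.Ico (⌈s⌉₊ - M) (n + 1),
      |(upsOp (etaD d))^[M] r ℓ * Zker d ℓ (Real.cos θ)|
        ≤ C1 * ((M : ℝ) + 1) ^ (2 * M) * m * (C2 * (((M : ℝ) + 3) * t) ^ (d - 1)) := by
    intro ℓ hl
    rw [Finset.mem_Ico] at hl
    have h1 : s ≤ (ℓ : ℝ) + M := by
      have : ⌈s⌉₊ ≤ ℓ + M := by omega
      exact_mod_cast Nat.ceil_le.1 this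
    have h2 : (ℓ : ℝ) + 1 ≤ ((M : ℝ) + 3) * t := by
      have : ℓ ≤ ⌊t⌋₊ + 1 + M := by omega
      have : (ℓ : ℝ) ≤ (⌊t⌋₊ : ℝ) + 1 + M := by exact_mod_cast this
      nlinarith [Nat.cast_nonneg (α := ℝ) M]
    rw [abs_mul]
    refine mul_le_mul (hterm ℓ h1) ((hZ ℓ θ).trans ?_) (abs_nonneg _) (by positivity)
    gcongr
  refine (Finset.abs_sum_le_sum_abs _ _).trans ((Finset.sum_le_card_nsmul _ _ _ hB).trans ?_)
  rw [Nat.card_Ico, nsmul_eq_mul]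
  have hcard : ((n + 1 - (⌈s⌉₊ - M) : ℕ) : ℝ) ≤ (1 + (2 * M + 3) / h 0) * (t - s) := by
    have h1 : ((n + 1 - (⌈s⌉₊ - M) : ℕ) : ℝ) ≤ t - s + (2 * M + 3) := by
      have h2 : s ≤ ⌈s⌉₊ := Nat.le_ceil s
      have h4 : ⌈s⌉₊ ≤ ⌊t⌋₊ + 1 := by
        rw [Nat.ceil_le]
        have := (Nat.lt_floor_add_one t).le
        push_cast
        linarith
      have h3 : (n + 1 - (⌈s⌉₊ - M)) + ⌈s⌉₊ ≤ ⌊t⌋₊ + 2 + 2 * M := by omega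
      have h3' : ((n + 1 - (⌈s⌉₊ - M) : ℕ) : ℝ) + ⌈s⌉₊ ≤ (⌊t⌋₊ : ℝ) + 2 + 2 * M := by
        exact_mod_cast h3
      linarith
    have h2 : (2 * (M : ℝ) + 3) ≤ (2 * M + 3) / h 0 * (t - s) := by
      rw [div_mul_eq_mul_div, le_div_iff₀ h00]
      gcongr
    linarith
  have hpow : t ^ (d - 1) * (t - s) ≤ t ^ d - s ^ d := by
    have e : d = (d - 1) + 1 := by omega
    have h1 : s ^ d ≤ t ^ (d - 1) * s := by
      conv_lhs => rw [e, pow_succ]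
      have : s ≤ t := by linarith
      gcongr
    have h2 : t ^ d = t ^ (d - 1) * t := by
      conv_lhs => rw [e, pow_succ]
    rw [h2]; linarith
  have hpos : 0 ≤ t ^ d - s ^ d := le_trans (by
    have : 0 ≤ t - s := by linarith
    positivity) hpow
  set P := (C1 * ((M : ℝ) + 1) ^ (2 * M)) * (C2 * ((M : ℝ) + 3) ^ (d - 1))
    * (1 + (2 * M + 3) / h 0) with hP
  have hP0 : 0 ≤ P := by positivity
  calc _ ≤ (1 + (2 * M + 3) / h 0) * (t - s) *
        (C1 * ((M : ℝ) + 1) ^ (2 * M) * m * (C2 * (((M : ℝ) + 3) * t) ^ (d - 1))) := by gcongr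
    _ = P * (t ^ (d - 1) * (t - s)) * m := by rw [hP, mul_pow]; ring
    _ ≤ P * (t ^ d - s ^ d) * m := by gcongr
    _ ≤ (P + 1) * (t ^ d - s ^ d) * m := by gcongr; linarith
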